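/- arXiv:1305.4897 — 10 statements merged into one kernel-verified Lean document; each statement's English description precedes it below -/
import Mathlib

section
/- Let (D, R, w, c, (R_i), (D_j)) be a resource allocation instance and let (s, o) be a stable configuration for it. Then every claim satisfies 0 ≤ s i ≤ w i and every offer satisfies o j ≥ 0. -/
open Classical Finset

/-- A resource allocation instance: finite sets `D` of demands and `R` of resources,
nonnegative demand magnitudes `w`, nonnegative capacities `c`, and for each demand `i`
a nonempty set `Ri i` of required resources, such that every resource is required by
at least one demand. -/
structure RAInstance (D R : Type*) [Fintype D] [Fintype R] where
  w : D → ℝ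
  c : R → ℝ
  Ri : D → Finset R
  w_nonneg : ∀ i, 0 ≤ w i
  c_nonneg : ∀ j, 0 ≤ c j
  Ri_nonempty : ∀ i, (Ri i).Nonempty
  Dj_nonempty : ∀ j : R, (Finset.univ.filter fun i => j ∈ Ri i).Nonempty

variable {D R : Type*} [Fintype D] [Fintype R]

/-- The set `D_j` of demands requiring resource `j`. -/
noncomputable def RAInstance.Dj (I : RAInstance D R) (j : R) : Finset D :=
  Finset.univ.filter fun i => j ∈ I.Ri i

theorem RAInstance.Dj_nonempty' (I : RAInstance D R) (j : R) : (I.Dj j).Nonempty :=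
  I.Dj_nonempty j

/-- `o` is an auction offer for claims `x` on the nonempty finite bidder set `B` with
capacity `c`: with `B* = {b ∈ B : x b < o}` and `A = c - ∑_{b ∈ B*} x b`, we have
`o = A / |B \ B*|` when `B* ≠ B`, and `o = A + max {x b : b ∈ B}` when `B* = B`. -/
def IsAuctionOffer {ι : Type*} (B : Finset ι) (hB : B.Nonempty) (x : ι → ℝ) (c o : ℝ) : Prop :=
  let Bs := B.filter fun b => x b < o
  let A := c - ∑ b ∈ Bs, x b
  if Bs = B then o = A + B.sup' hB x
  else o = A / ((B \ Bs).card : ℝ)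

/-- A stable configuration `(s, o)`: every claim is the minimum of the demand magnitude
and the smallest adjacent offer, and every offer is an auction offer for the adjacent
claims. -/
def IsStableConfig (I : RAInstance D R) (s : D → ℝ) (o : R → ℝ) : Prop :=
  (∀ i, s i = min (I.w i) ((I.Ri i).inf' (I.Ri_nonempty i) o)) ∧
  ∀ j, IsAuctionOffer (I.Dj j) (I.Dj_nonempty' j) s (I.c j) (o j)

/-- If no bidder claims less than the offer, the offer is nonnegative whenever the capacity is. -/
theorem IsAuctionOffer.nonneg_of_le {ι : Type*} {B : Finset ι} {hB : B.Nonempty} {x : ι → ℝ}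
    {c o : ℝ} (h : IsAuctionOffer B hB x c o) (hc : 0 ≤ c) (hx : ∀ b ∈ B, o ≤ x b) : 0 ≤ o := by
  have hBs : (B.filter fun b => x b < o) = ∅ :=
    Finset.filter_eq_empty_iff.2 fun b hb => not_lt.2 (hx b hb)
  simp only [IsAuctionOffer, hBs, if_neg hB.ne_empty.symm, Finset.sum_empty, sub_zero] at h
  rw [h]
  positivity

/-- In a stable configuration, every offer is nonnegative. -/
theorem IsStableConfig.offer_nonneg {I : RAInstance D R} {s : D → ℝ} {o : R → ℝ}
    (h : IsStableConfig I s o) (j : R) : 0 ≤ o j := by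
  obtain ⟨k, -, hk⟩ := Finset.exists_min_image Finset.univ o ⟨j, Finset.mem_univ j⟩
  by_contra! hj
  have hneg : o k < 0 := (hk j (Finset.mem_univ j)).trans_lt hj
  refine hneg.not_ge ((h.2 k).nonneg_of_le (I.c_nonneg k) fun i _ => ?_)
  rw [h.1 i]
  exact le_min (hneg.le.trans (I.w_nonneg i))
    (Finset.le_inf' _ _ fun l _ => hk l (Finset.mem_univ l))

/-- In a stable configuration, every claim satisfies `0 ≤ s i ≤ w i` and every
offer satisfies `o j ≥ 0`. -/
theorem stable_config_claims_bounds_and_offers_nonneg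
    (I : RAInstance D R) (s : D → ℝ) (o : R → ℝ)
    (h : IsStableConfig I s o) :
    (∀ i, 0 ≤ s i ∧ s i ≤ I.w i) ∧ (∀ j, 0 ≤ o j) := by
  refine ⟨fun i => ?_, h.offer_nonneg⟩
  rw [h.1 i]
  exact ⟨le_min (I.w_nonneg i) (Finset.le_inf' _ _ fun j _ => h.offer_nonneg j), min_le_left _ _⟩
end

section
/- Let (D, R, w, c, (R_i), (D_j)) be a resource allocation instance and let (s, o) be a stable configuration for it. Then the allocation s is feasible: 0 ≤ s i ≤ w i for every demand i and ∑_{i ∈ D_j} s i ≤ c j for every resource j. -/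
open Classical Finset

variable {D R : Type*} [Fintype D] [Fintype R]

/-- An allocation `s` is feasible: `0 ≤ s i ≤ w i` for every demand and the claims at
every resource do not exceed its capacity. -/
def IsFeasible (I : RAInstance D R) (s : D → ℝ) : Prop :=
  (∀ i, 0 ≤ s i ∧ s i ≤ I.w i) ∧ ∀ j, ∑ i ∈ I.Dj j, s i ≤ I.c j

/-- An auction offer with nonnegative capacity is nonnegative, whatever the claims are. -/
theorem IsAuctionOffer.nonneg {ι : Type*} {B : Finset ι} {hB : B.Nonempty} {x : ι → ℝ}
    {c o : ℝ} (h : IsAuctionOffer B hB x c o) (hc : 0 ≤ c) : 0 ≤ o := by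
  by_contra! ho
  unfold IsAuctionOffer at h
  dsimp only at h
  split_ifs at h with hBs
  · rw [hBs] at h
    have hlt : ∀ b ∈ B, x b < o := Finset.filter_eq_self.mp hBs
    obtain ⟨m, hm, hmax⟩ := B.exists_mem_eq_sup' hB x
    have hsum : ∑ b ∈ B, x b ≤ x m := by
      rw [← Finset.add_sum_erase B x hm]
      have : ∑ b ∈ B.erase m, x b ≤ 0 := Finset.sum_nonpos fun b hb =>
        ((hlt b (Finset.mem_of_mem_erase hb)).trans ho).le
      linarith
    linarith
  · have hsum : ∑ b ∈ B.filter (fun b => x b < o), x b ≤ 0 := Finset.sum_nonpos fun b hb =>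
      ((Finset.mem_filter.mp hb).2.trans ho).le
    refine ho.not_ge (h ▸ div_nonneg ?_ (Nat.cast_nonneg _))
    linarith

/-- Claims bounded by an auction offer do not exceed the capacity. -/
theorem IsAuctionOffer.sum_le {ι : Type*} {B : Finset ι} {hB : B.Nonempty} {x : ι → ℝ}
    {c o : ℝ} (h : IsAuctionOffer B hB x c o) (hx : ∀ b ∈ B, x b ≤ o) :
    ∑ b ∈ B, x b ≤ c := by
  unfold IsAuctionOffer at h
  dsimp only at h
  split_ifs at h with hBs
  · rw [hBs] at h
    have hlt : B.sup' hB x < o := (Finset.sup'_lt_iff hB).mpr (Finset.filter_eq_self.mp hBs)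
    linarith
  · have hsub : B.filter (fun b => x b < o) ⊆ B := Finset.filter_subset _ _
    have hne : (B \ B.filter fun b => x b < o).Nonempty :=
      Finset.sdiff_nonempty.mpr fun hle => hBs (hsub.antisymm hle)
    have hcard : ((B \ B.filter fun b => x b < o).card : ℝ) ≠ 0 :=
      Nat.cast_ne_zero.mpr hne.card_ne_zero
    have hconst : ∑ b ∈ B \ B.filter (fun b => x b < o), x b =
        (B \ B.filter fun b => x b < o).card * o := by
      rw [← nsmul_eq_mul]
      refine Finset.sum_eq_card_nsmul fun b hb => ?_
      obtain ⟨hbB, hbs⟩ := Finset.mem_sdiff.mp hb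
      exact (hx b hbB).antisymm (not_lt.mp fun hlt => hbs (Finset.mem_filter.mpr ⟨hbB, hlt⟩))
    rw [eq_div_iff hcard] at h
    rw [← Finset.sum_sdiff hsub]
    linarith

/-- In a stable configuration, the allocation `s` is feasible: `0 ≤ s i ≤ w i` for every
demand `i` and `∑_{i ∈ D_j} s i ≤ c j` for every resource `j`. -/
theorem stable_config_feasible
    (I : RAInstance D R) (s : D → ℝ) (o : R → ℝ)
    (h : IsStableConfig I s o) :
    IsFeasible I s := by
  obtain ⟨hs, ho⟩ := h
  refine ⟨fun i => ⟨?_, (hs i).trans_le (min_le_left _ _)⟩, fun j => (ho j).sum_le fun i hi => ?_⟩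
  · rw [hs i]
    exact le_min (I.w_nonneg i)
      (Finset.le_inf' _ _ fun j _ => (ho j).nonneg (I.c_nonneg j))
  · exact (hs i).trans_le
      ((min_le_right _ _).trans (Finset.inf'_le o (Finset.mem_filter.mp hi).2))
end

section
/- Let (D, R, w, c, (R_i), (D_j)) be a resource allocation instance and let (s, o) be a stable configuration for it. If some demand i ∈ D_j has s i ≥ o j, then s i = o j, s i = max{s k : k ∈ D_j}, and resource j is exactly saturated: ∑_{k ∈ D_j} s k = c j. -/
open Classical Finset

variable {D R : Type*} [Fintype D] [Fintype R]

/-- An auction offer that bounds all claims and is attained by one of them allocates the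
whole capacity. -/
theorem IsAuctionOffer.sum_eq_of_le {ι : Type*} {B : Finset ι} {hB : B.Nonempty} {x : ι → ℝ}
    {c o : ℝ} (h : IsAuctionOffer B hB x c o) (hle : ∀ b ∈ B, x b ≤ o)
    {i : ι} (hi : i ∈ B) (hoi : o ≤ x i) : ∑ b ∈ B, x b = c := by
  have hmem : i ∉ B.filter fun b => x b < o := fun hf =>
    (Finset.mem_filter.mp hf).2.not_ge hoi
  have hne : (B.filter fun b => x b < o) ≠ B := fun heq => hmem (heq.symm ▸ hi)
  have hoff : o = (c - ∑ b ∈ B.filter fun b => x b < o, x b) /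
      ((B \ B.filter fun b => x b < o).card : ℝ) := by
    simpa only [IsAuctionOffer, if_neg hne] using h
  have hcard : ((B \ B.filter fun b => x b < o).card : ℝ) ≠ 0 :=
    Nat.cast_ne_zero.mpr (Finset.card_ne_zero_of_mem (Finset.mem_sdiff.mpr ⟨hi, hmem⟩))
  have hconst : ∑ b ∈ B \ B.filter fun b => x b < o, x b =
      ((B \ B.filter fun b => x b < o).card : ℝ) * o := by
    rw [← nsmul_eq_mul]
    refine Finset.sum_eq_card_nsmul fun b hb => ?_
    obtain ⟨hbB, hbf⟩ := Finset.mem_sdiff.mp hb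
    exact (hle b hbB).antisymm
      (not_lt.mp fun hlt => hbf (Finset.mem_filter.mpr ⟨hbB, hlt⟩))
  rw [eq_div_iff hcard] at hoff
  rw [← Finset.sum_sdiff (Finset.filter_subset (fun b => x b < o) B), hconst]
  linarith

/-- In a stable configuration, no claim exceeds an adjacent offer. -/
theorem IsStableConfig.claim_le_offer {I : RAInstance D R} {s : D → ℝ} {o : R → ℝ}
    (h : IsStableConfig I s o) {j : R} {k : D} (hk : k ∈ I.Dj j) : s k ≤ o j := by
  rw [h.1 k]
  exact (min_le_right _ _).trans (Finset.inf'_le o (Finset.mem_filter.mp hk).2)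

/-- In a stable configuration, if some demand `i ∈ D_j` has `s i ≥ o j`, then
`s i = o j`, `s i` is the maximal claim at `j`, and resource `j` is exactly
saturated: `∑_{k ∈ D_j} s k = c j`. -/
theorem stable_config_maximal_claim_saturates
    (I : RAInstance D R) (s : D → ℝ) (o : R → ℝ)
    (h : IsStableConfig I s o)
    (j : R) (i : D) (hi : i ∈ I.Dj j) (hso : o j ≤ s i) :
    s i = o j ∧ s i = (I.Dj j).sup' (I.Dj_nonempty' j) s ∧
      ∑ k ∈ I.Dj j, s k = I.c j := by
  have hle : ∀ k ∈ I.Dj j, s k ≤ o j := fun k hk => h.claim_le_offer hk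
  refine ⟨(hle i hi).antisymm hso, ?_, (h.2 j).sum_eq_of_le hle hi hso⟩
  exact (Finset.le_sup' s hi).antisymm
    (Finset.sup'_le _ _ fun k hk => (hle k hk).trans hso)
end

section
/- For every finite nonempty set B, every claims function x : B → ℝ with x b ≥ 0 for all b, and every capacity c ≥ 0, there exists a real number o that is an auction offer for (x, c). -/
open Classical Finset

/-- Sharing `o` equally among the large claims: the capped claims split into the claims below `o`
and a copy of `o` for every other claim. -/
theorem sum_min_eq_sum_filter_add_card_mul {ι : Type*} (B : Finset ι) (x : ι → ℝ) (o : ℝ) :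
    ∑ b ∈ B, min (x b) o = ∑ b ∈ B.filter (fun b => x b < o), x b
      + ((B \ B.filter fun b => x b < o).card : ℝ) * o := by
  rw [← sum_filter_add_sum_filter_not B (fun b => x b < o), ← filter_not, ← nsmul_eq_mul,
    ← sum_const]
  congr 1
  · exact sum_congr rfl fun b hb => min_eq_left (mem_filter.1 hb).2.le
  · exact sum_congr rfl fun b hb => min_eq_right (not_lt.1 (mem_filter.1 hb).2)

/-- A capacity at most the total claim is exhausted by capping all claims at some level. -/
theorem exists_sum_min_eq {ι : Type*} (B : Finset ι) (hB : B.Nonempty) (x : ι → ℝ)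
    (hx : ∀ b ∈ B, 0 ≤ x b) (c : ℝ) (hc : 0 ≤ c) (hcs : c ≤ ∑ b ∈ B, x b) :
    ∃ o ≤ B.sup' hB x, ∑ b ∈ B, min (x b) o = c := by
  obtain ⟨b₀, hb₀⟩ := hB
  have hmax : 0 ≤ B.sup' ⟨b₀, hb₀⟩ x := (hx b₀ hb₀).trans (le_sup' x hb₀)
  have hcont : ContinuousOn (fun o => ∑ b ∈ B, min (x b) o) (Set.Icc 0 (B.sup' ⟨b₀, hb₀⟩ x)) := by
    fun_prop
  have hzero : ∑ b ∈ B, min (x b) 0 = 0 := sum_eq_zero fun b hb => min_eq_right (hx b hb)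
  have htop : ∑ b ∈ B, min (x b) (B.sup' ⟨b₀, hb₀⟩ x) = ∑ b ∈ B, x b :=
    sum_congr rfl fun b hb => min_eq_left (le_sup' x hb)
  obtain ⟨o, ho, hoc⟩ := intermediate_value_Icc hmax hcont
    (show c ∈ Set.Icc _ _ from ⟨hzero.trans_le hc, hcs.trans_eq htop.symm⟩)
  exact ⟨o, ho.2, hoc⟩

/-- For every finite nonempty bidder set `B`, nonnegative claims `x`, and capacity
`c ≥ 0`, there exists an auction offer for `(x, c)`. -/
theorem auction_offer_exists {ι : Type*} (B : Finset ι) (hB : B.Nonempty)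
    (x : ι → ℝ) (hx : ∀ b ∈ B, 0 ≤ x b) (c : ℝ) (hc : 0 ≤ c) :
    ∃ o : ℝ, IsAuctionOffer B hB x c o := by
  rcases le_or_gt c (∑ b ∈ B, x b) with hcs | hcs
  · obtain ⟨o, ho, hoc⟩ := exists_sum_min_eq B hB x hx c hc hcs
    have hne : B.filter (fun b => x b < o) ≠ B := by
      obtain ⟨b, hb, hbmax⟩ := exists_mem_eq_sup' hB x
      exact fun h => (filter_eq_self.1 h b hb).not_ge (hbmax ▸ ho)
    have hcard : ((B \ B.filter fun b => x b < o).card : ℝ) ≠ 0 := by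
      rw [Nat.cast_ne_zero, card_ne_zero, sdiff_nonempty]
      exact fun h => hne ((filter_subset _ B).antisymm h)
    rw [sum_min_eq_sum_filter_add_card_mul] at hoc
    refine ⟨o, ?_⟩
    simp only [IsAuctionOffer, if_neg hne]
    rw [eq_div_iff hcard]
    linarith
  · refine ⟨c - ∑ b ∈ B, x b + B.sup' hB x, ?_⟩
    have hall : B.filter (fun b => x b < c - ∑ b ∈ B, x b + B.sup' hB x) = B :=
      filter_eq_self.2 fun b hb => by linarith [le_sup' x hb]
    simp only [IsAuctionOffer, hall, if_true]
end

section
/- For every finite nonempty set B, every claims function x : B → ℝ with x b ≥ 0 for all b, and every capacity c ≥ 0, the auction offer for (x, c) is unique: if o and o' are both auction offers for (x, c) then o = o'. -/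
open Classical Finset

/-- If every claim is below the offer, the offer exceeds the largest claim by the surplus
capacity, which is positive; otherwise the claims truncated at the offer sum to the capacity. -/
theorem IsAuctionOffer.surplus_or_sum_min_eq {ι : Type*} {B : Finset ι} {hB : B.Nonempty}
    {x : ι → ℝ} {c o : ℝ} (h : IsAuctionOffer B hB x c o) :
    (o = c - ∑ b ∈ B, x b + B.sup' hB x ∧ ∑ b ∈ B, x b < c) ∨
      ((∃ b ∈ B, o ≤ x b) ∧ ∑ b ∈ B, min (x b) o = c) := by
  unfold IsAuctionOffer at h
  dsimp only at h
  split_ifs at h with hBs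
  · left
    rw [hBs] at h
    have hlt : B.sup' hB x < o := (Finset.sup'_lt_iff hB).2 (Finset.filter_eq_self.1 hBs)
    exact ⟨h, by linarith⟩
  · right
    have hex : ∃ b ∈ B, o ≤ x b := by
      by_contra! hall
      exact hBs (Finset.filter_eq_self.2 hall)
    refine ⟨hex, ?_⟩
    rw [← Finset.filter_not] at h
    have hcard : ((B.filter fun b => ¬ x b < o).card : ℝ) ≠ 0 := by
      obtain ⟨b, hb, hob⟩ := hex
      exact Nat.cast_ne_zero.2
        (Finset.card_ne_zero_of_mem (Finset.mem_filter.2 ⟨hb, not_lt.2 hob⟩))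
    rw [eq_div_iff hcard] at h
    have hlow : ∑ b ∈ B with x b < o, min (x b) o = ∑ b ∈ B with x b < o, x b :=
      Finset.sum_congr rfl fun b hb => min_eq_left (Finset.mem_filter.1 hb).2.le
    have hhigh : ∑ b ∈ B with ¬ x b < o, min (x b) o =
        o * (B.filter fun b => ¬ x b < o).card := by
      rw [Finset.sum_congr rfl fun b hb =>
        min_eq_right (not_lt.1 (Finset.mem_filter.1 hb).2), Finset.sum_const, nsmul_eq_mul,
        mul_comm]
    rw [← Finset.sum_filter_add_sum_filter_not B (fun b => x b < o), hlow, hhigh]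
    linarith

/-- Raising the truncation level up to at most some claim strictly raises the sum of the
truncated claims. -/
theorem sum_min_lt_sum_min {ι : Type*} {B : Finset ι} {x : ι → ℝ} {o o' : ℝ}
    (hlt : o < o') (h : ∃ b ∈ B, o' ≤ x b) :
    ∑ b ∈ B, min (x b) o < ∑ b ∈ B, min (x b) o' := by
  obtain ⟨b, hb, hob⟩ := h
  refine Finset.sum_lt_sum (fun a _ => min_le_min_left _ hlt.le) ⟨b, hb, ?_⟩
  rwa [min_eq_right hob, min_eq_right (hlt.le.trans hob)]

/-- The auction offer for nonnegative claims `x` on a finite nonempty bidder set `B`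
with capacity `c ≥ 0` is unique. -/
theorem auction_offer_unique {ι : Type*} (B : Finset ι) (hB : B.Nonempty)
    (x : ι → ℝ) (hx : ∀ b ∈ B, 0 ≤ x b) (c : ℝ) (hc : 0 ≤ c)
    (o o' : ℝ) (ho : IsAuctionOffer B hB x c o) (ho' : IsAuctionOffer B hB x c o') :
    o = o' := by
  have hle (t : ℝ) : ∑ b ∈ B, min (x b) t ≤ ∑ b ∈ B, x b :=
    Finset.sum_le_sum fun b _ => min_le_left _ _
  rcases ho.surplus_or_sum_min_eq with ⟨h, hc₁⟩ | ⟨hex, hsum⟩ <;>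
    rcases ho'.surplus_or_sum_min_eq with ⟨h', hc₂⟩ | ⟨hex', hsum'⟩
  · rw [h, h']
  · linarith [hle o']
  · linarith [hle o]
  · rcases lt_trichotomy o o' with hlt | heq | hlt
    · linarith [sum_min_lt_sum_min hlt hex']
    · exact heq
    · linarith [sum_min_lt_sum_min hlt hex]
end

section
/- The auction offer is antitone in the claims: let B be a finite nonempty set, c ≥ 0, and x, x' : B → ℝ with 0 ≤ x' b ≤ x b for all b ∈ B; if o is an auction offer for (x, c) and o' is an auction offer for (x', c), then o' ≥ o. -/
open Classical Finset

/-- An auction offer either is at most some claim and exhausts the capacity when every claim is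
capped at it, or exceeds all claims. -/
theorem IsAuctionOffer.capped_or_exceeds {ι : Type*} {B : Finset ι} {hB : B.Nonempty}
    {x : ι → ℝ} {c o : ℝ} (h : IsAuctionOffer B hB x c o) :
    ((∃ b ∈ B, o ≤ x b) ∧ ∑ b ∈ B, min (x b) o = c) ∨
      ((∀ b ∈ B, x b < o) ∧ o = c - ∑ b ∈ B, x b + B.sup' hB x) := by
  unfold IsAuctionOffer at h
  dsimp only at h
  split_ifs at h with hall
  · rw [hall] at h
    exact Or.inr ⟨Finset.filter_eq_self.mp hall, h⟩
  · left
    have hex : ∃ b ∈ B, o ≤ x b := by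
      by_contra! hlt
      exact hall (Finset.filter_eq_self.mpr hlt)
    refine ⟨hex, ?_⟩
    obtain ⟨b, hb, hob⟩ := hex
    rw [← Finset.filter_not] at h
    have hpos : (0 : ℝ) < ((B.filter fun b => ¬ x b < o).card : ℝ) :=
      Nat.cast_pos.mpr (Finset.card_pos.mpr ⟨b, Finset.mem_filter.mpr ⟨hb, hob.not_gt⟩⟩)
    rw [eq_div_iff hpos.ne'] at h
    rw [← Finset.sum_filter_add_sum_filter_not B (fun b => x b < o)]
    have hlow : ∑ b ∈ B with x b < o, min (x b) o = ∑ b ∈ B with x b < o, x b :=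
      Finset.sum_congr rfl fun b hb => min_eq_left (Finset.mem_filter.mp hb).2.le
    have hhigh : ∑ b ∈ B with ¬ x b < o, min (x b) o = ∑ b ∈ B with ¬ x b < o, o :=
      Finset.sum_congr rfl fun b hb => min_eq_right (not_lt.mp (Finset.mem_filter.mp hb).2)
    rw [hlow, hhigh, Finset.sum_const, nsmul_eq_mul]
    linarith

/-- The auction offer is antitone in the claims: pointwise smaller (still nonnegative)
claims yield an offer at least as large. -/
theorem auction_offer_antitone_claims {ι : Type*} (B : Finset ι) (hB : B.Nonempty)
    (c : ℝ) (hc : 0 ≤ c) (x x' : ι → ℝ)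
    (hx' : ∀ b ∈ B, 0 ≤ x' b) (hle : ∀ b ∈ B, x' b ≤ x b)
    (o o' : ℝ) (ho : IsAuctionOffer B hB x c o) (ho' : IsAuctionOffer B hB x' c o') :
    o ≤ o' := by
  by_contra! hlt
  rcases ho'.capped_or_exceeds with ⟨⟨b', hb', hob'⟩, hsum'⟩ | ⟨hall', heq'⟩
  · rcases ho.capped_or_exceeds with ⟨⟨b, hb, hob⟩, hsum⟩ | ⟨hall, heq⟩
    · have hmin : ∀ i ∈ B, min (x' i) o' ≤ min (x i) o := fun i hi =>
        min_le_min (hle i hi) hlt.le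
      have hmineq := (Finset.sum_eq_sum_iff_of_le hmin).mp (hsum'.trans hsum.symm) b hb
      rw [min_eq_right hob] at hmineq
      linarith [min_le_right (x' b) o']
    · have hmax : B.sup' hB x < o := (Finset.sup'_lt_iff hB).mpr hall
      have hcap : ∑ b ∈ B, min (x' b) o' ≤ ∑ b ∈ B, x b :=
        Finset.sum_le_sum fun b hb => (min_le_left _ _).trans (hle b hb)
      linarith
  · have key : ∀ (y : ι → ℝ), (∀ i ∈ B, x' i ≤ y i) → ∀ b ∈ B,
        y b - B.sup' hB x' ≤ ∑ i ∈ B, y i - ∑ i ∈ B, x' i := by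
      intro y hy b hb
      rw [← Finset.sum_sub_distrib]
      have hsingle := Finset.single_le_sum (f := fun i => y i - x' i)
        (fun i hi => sub_nonneg.mpr (hy i hi)) hb
      have hmax := Finset.le_sup' x' hb
      linarith
    rcases ho.capped_or_exceeds with ⟨⟨b, hb, hob⟩, hsum⟩ | ⟨hall, heq⟩
    · have h := key (fun i => min (x i) o)
        (fun i hi => le_min (hle i hi) ((hall' i hi).trans hlt).le) b hb
      rw [min_eq_right hob, hsum] at h
      linarith
    · obtain ⟨b, hb, hmax⟩ := Finset.exists_mem_eq_sup' hB x
      have h := key x hle b hb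
      linarith
end

section
/- The auction offer is monotone in the capacity: let B be a finite nonempty set, x : B → ℝ with x b ≥ 0 for all b, and 0 ≤ c ≤ c'; if o is an auction offer for (x, c) and o' is an auction offer for (x, c'), then o' ≥ o. -/
open Classical Finset

/-- An auction offer `o` distributes exactly the capacity: each claim is served up to `o`, and
the excess of `o` over the largest claim accounts for what is left. -/
theorem IsAuctionOffer.sum_min_add_max_eq {ι : Type*} {B : Finset ι} {hB : B.Nonempty} {x : ι → ℝ}
    {c o : ℝ} (h : IsAuctionOffer B hB x c o) :
    ∑ b ∈ B, min (x b) o + max (o - B.sup' hB x) 0 = c := by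
  simp only [IsAuctionOffer] at h
  split_ifs at h with hBs
  · have hlt : ∀ b ∈ B, x b < o := Finset.filter_eq_self.mp hBs
    have hsum : ∑ b ∈ B, min (x b) o = ∑ b ∈ B, x b :=
      Finset.sum_congr rfl fun b hb => min_eq_left (hlt b hb).le
    have hsup : B.sup' hB x < o := (Finset.sup'_lt_iff hB).mpr hlt
    rw [hBs] at h
    rw [hsum, max_eq_left (sub_nonneg.mpr hsup.le)]
    linarith
  · obtain ⟨b, hb, hob⟩ : ∃ b ∈ B, o ≤ x b := by
      by_contra! hlt
      exact hBs (Finset.filter_eq_self.mpr hlt)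
    have hsup : o ≤ B.sup' hB x := hob.trans (Finset.le_sup' x hb)
    have hcard : ((B \ B.filter fun b => x b < o).card : ℝ) ≠ 0 :=
      Nat.cast_ne_zero.mpr (Finset.card_ne_zero_of_mem (a := b) (by simp [hb, hob]))
    have hserved : ∑ b ∈ B.filter (fun b => x b < o), min (x b) o =
        ∑ b ∈ B.filter (fun b => x b < o), x b :=
      Finset.sum_congr rfl fun b hb => min_eq_left (Finset.mem_filter.mp hb).2.le
    have hcapped : ∑ b ∈ B \ B.filter (fun b => x b < o), min (x b) o =
        ((B \ B.filter fun b => x b < o).card : ℝ) * o := by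
      rw [← nsmul_eq_mul, ← Finset.sum_const]
      refine Finset.sum_congr rfl fun b hb => min_eq_right ?_
      simp only [Finset.mem_sdiff, Finset.mem_filter, not_and, not_lt] at hb
      exact hb.2 hb.1
    rw [eq_div_iff hcard] at h
    rw [← Finset.sum_sdiff (Finset.filter_subset (fun b => x b < o) B), hserved, hcapped,
      max_eq_right (sub_nonpos.mpr hsup)]
    linarith

theorem strictMono_sum_min_add_max {ι : Type*} (B : Finset ι) (hB : B.Nonempty) (x : ι → ℝ) :
    StrictMono fun o => ∑ b ∈ B, min (x b) o + max (o - B.sup' hB x) 0 := by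
  intro o o' hoo'
  have hmin : ∀ b ∈ B, min (x b) o ≤ min (x b) o' := fun b _ => min_le_min_left _ hoo'.le
  rcases le_or_gt (B.sup' hB x) o with hsup | hsup
  · refine add_lt_add_of_le_of_lt (Finset.sum_le_sum hmin) ?_
    rw [max_eq_left (sub_nonneg.mpr hsup), max_eq_left (sub_nonneg.mpr (hsup.trans hoo'.le))]
    exact sub_lt_sub_right hoo' _
  · obtain ⟨b, hb, hob⟩ := (Finset.lt_sup'_iff hB).mp hsup
    refine add_lt_add_of_lt_of_le (Finset.sum_lt_sum hmin ⟨b, hb, ?_⟩)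
      (max_le_max_right _ (sub_le_sub_right hoo'.le _))
    rw [min_eq_right hob.le]
    exact lt_min hob hoo'


/-- The auction offer is monotone in the capacity: a larger capacity yields an offer
at least as large. -/
theorem auction_offer_monotone_capacity {ι : Type*} (B : Finset ι) (hB : B.Nonempty)
    (x : ι → ℝ) (hx : ∀ b ∈ B, 0 ≤ x b)
    (c c' : ℝ) (hc : 0 ≤ c) (hcc' : c ≤ c')
    (o o' : ℝ) (ho : IsAuctionOffer B hB x c o) (ho' : IsAuctionOffer B hB x c' o') :
    o ≤ o' := by
  rw [← ho.sum_min_add_max_eq, ← ho'.sum_min_add_max_eq] at hcc'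
  exact (strictMono_sum_min_add_max B hB x).le_iff_le.mp hcc'
end

section
/- The auction offer is insensitive to the exact values of claims at or above the offer: let B be a finite nonempty set, c ≥ 0, x : B → ℝ with x b ≥ 0 for all b, and let o be an auction offer for (x, c) such that some bidder has x b ≥ o. If x' : B → ℝ satisfies x' b = x b for every b with x b < o, and x' b ≥ o for every b with x b ≥ o, then o is also an auction offer for (x', c). -/
open Classical Finset

/-- The auction offer is insensitive to the exact values of claims at or above the
offer: if `x'` agrees with `x` on claims below `o` and stays at least `o` on claims
at least `o`, then `o` is also an auction offer for `(x', c)`. -/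
theorem auction_offer_insensitive {ι : Type*} (B : Finset ι) (hB : B.Nonempty)
    (c : ℝ) (hc : 0 ≤ c) (x : ι → ℝ) (hx : ∀ b ∈ B, 0 ≤ x b)
    (o : ℝ) (ho : IsAuctionOffer B hB x c o)
    (hbig : ∃ b ∈ B, o ≤ x b)
    (x' : ι → ℝ)
    (hlow : ∀ b ∈ B, x b < o → x' b = x b)
    (hhigh : ∀ b ∈ B, o ≤ x b → o ≤ x' b) :
    IsAuctionOffer B hB x' c o := by
  have hfilter : (B.filter fun b => x' b < o) = B.filter fun b => x b < o := by
    refine Finset.filter_congr fun b hb => ⟨fun h => ?_, fun h => ?_⟩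
    · by_contra hxb
      exact absurd (hhigh b hb (not_lt.mp hxb)) (not_le.mpr h)
    · rwa [hlow b hb h]
  have hsum : ∑ b ∈ B.filter (fun b => x b < o), x' b =
      ∑ b ∈ B.filter (fun b => x b < o), x b :=
    Finset.sum_congr rfl fun b hb =>
      hlow b (Finset.mem_filter.mp hb).1 (Finset.mem_filter.mp hb).2
  have hne : (B.filter fun b => x b < o) ≠ B := by
    obtain ⟨b, hb, hob⟩ := hbig
    exact fun h => absurd (Finset.filter_eq_self.mp h b hb) (not_lt.mpr hob)
  simp only [IsAuctionOffer, if_neg hne] at ho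
  simp only [IsAuctionOffer, hfilter, hsum, if_neg hne]
  exact ho
end

section
/- Correctness and termination of the UpdateOffer iteration: let B be a finite nonempty set, x : B → ℝ with x b ≥ 0 for all b, and c ≥ 0. Define o(S) for S ⊆ B by o(S) = (c − ∑_{b ∈ S} x b) / |B \ S| if S ≠ B and o(S) = (c − ∑_{b ∈ S} x b) + max{x b : b ∈ B} if S = B, and define the iteration S₀ = ∅, S_{k+1} = S_k ∪ {b ∈ B : x b < o(S_k)}. Then the sequence (S_k) is increasing and stabilizes after at most |B| steps, the sequence of offers o(S_k) is nondecreasing, and for the terminal set S the value o(S) is an auction offer for (x, c). -/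
open Classical Finset

/-- The trial offer `o(S)` associated with a set `S ⊆ B` of constrained bidders:
`o(S) = (c − ∑_{b ∈ S} x b) / |B \ S|` when `S ≠ B`, and
`o(S) = (c − ∑_{b ∈ S} x b) + max {x b : b ∈ B}` when `S = B`. -/
noncomputable def offerOf {ι : Type*} (B : Finset ι) (hB : B.Nonempty) (x : ι → ℝ)
    (c : ℝ) (S : Finset ι) : ℝ :=
  if S = B then (c - ∑ b ∈ S, x b) + B.sup' hB x
  else (c - ∑ b ∈ S, x b) / ((B \ S).card : ℝ)

/-- The `UpdateOffer` iteration: `S₀ = ∅`, `S_{k+1} = S_k ∪ {b ∈ B : x b < o(S_k)}`. -/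
noncomputable def updateOfferIter {ι : Type*} (B : Finset ι) (hB : B.Nonempty)
    (x : ι → ℝ) (c : ℝ) : ℕ → Finset ι
  | 0 => ∅
  | k + 1 =>
      updateOfferIter B hB x c k ∪
        B.filter fun b => x b < offerOf B hB x c (updateOfferIter B hB x c k)

section UpdateOffer

variable {ι : Type*} {B : Finset ι} {hB : B.Nonempty} {x : ι → ℝ} {c : ℝ}

theorem card_sdiff_mul_offerOf {S : Finset ι} (hS : S ⊆ B) (hne : S ≠ B) :
    ((B \ S).card : ℝ) * offerOf B hB x c S = c - ∑ b ∈ S, x b := by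
  have hpos : ((B \ S).card : ℝ) ≠ 0 := by
    rw [Nat.cast_ne_zero, Finset.card_ne_zero, Finset.sdiff_nonempty]
    exact fun h => hne (hS.antisymm h)
  rw [offerOf, if_neg hne, mul_div_cancel₀ _ hpos]

/-- Adding bidders whose claims do not exceed the trial offer does not decrease the offer. -/
theorem offerOf_le_offerOf {S T : Finset ι} (hST : S ⊆ T) (hTB : T ⊆ B)
    (hx : ∀ b ∈ T \ S, x b ≤ offerOf B hB x c S) :
    offerOf B hB x c S ≤ offerOf B hB x c T := by
  by_cases hS : S = B
  · rw [hST.antisymm (hS ▸ hTB)]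
  have hmul := card_sdiff_mul_offerOf (hB := hB) (x := x) (c := c) (hST.trans hTB) hS
  have hsum := Finset.sum_sdiff (f := x) hST
  by_cases hT : T = B
  · subst hT
    obtain ⟨a, ha⟩ : (T \ S).Nonempty :=
      Finset.sdiff_nonempty.2 fun h => hS (hST.antisymm h)
    have hle : ∑ b ∈ (T \ S).erase a, x b ≤
        ((T \ S).erase a).card • offerOf T hB x c S :=
      Finset.sum_le_card_nsmul _ _ _ fun b hb => hx b (Finset.mem_of_mem_erase hb)
    have hcard : (((T \ S).erase a).card : ℝ) + 1 = (T \ S).card := by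
      exact_mod_cast Finset.card_erase_add_one ha
    have hadd := Finset.sum_erase_add (T \ S) x ha
    have hmax : x a ≤ T.sup' hB x := Finset.le_sup' x (Finset.mem_sdiff.1 ha).1
    have hoffer : offerOf T hB x c T = (c - ∑ b ∈ T, x b) + T.sup' hB x := if_pos rfl
    rw [nsmul_eq_mul] at hle
    rw [← hcard] at hmul
    linarith
  · have hpos : (0 : ℝ) < (B \ T).card := by
      rw [Nat.cast_pos, Finset.card_pos, Finset.sdiff_nonempty]
      exact fun h => hT (hTB.antisymm h)
    have hle : ∑ b ∈ T \ S, x b ≤ (T \ S).card • offerOf B hB x c S :=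
      Finset.sum_le_card_nsmul _ _ _ hx
    have hcard : ((B \ S).card : ℝ) = (B \ T).card + (T \ S).card := by
      rw [Finset.cast_card_sdiff (hST.trans hTB), Finset.cast_card_sdiff hTB,
        Finset.cast_card_sdiff hST]
      ring
    rw [nsmul_eq_mul] at hle
    rw [hcard] at hmul
    refine le_of_mul_le_mul_left ?_ hpos
    rw [card_sdiff_mul_offerOf hTB hT]
    linarith

theorem isAuctionOffer_offerOf {S : Finset ι}
    (hS : (B.filter fun b => x b < offerOf B hB x c S) = S) :
    IsAuctionOffer B hB x c (offerOf B hB x c S) := by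
  unfold IsAuctionOffer
  simp only [hS]
  split_ifs with h
  · exact if_pos h
  · exact if_neg h

theorem updateOfferIter_succ (k : ℕ) :
    updateOfferIter B hB x c (k + 1) = updateOfferIter B hB x c k ∪
      B.filter fun b => x b < offerOf B hB x c (updateOfferIter B hB x c k) :=
  rfl

theorem updateOfferIter_subset_succ (k : ℕ) :
    updateOfferIter B hB x c k ⊆ updateOfferIter B hB x c (k + 1) :=
  Finset.subset_union_left

theorem updateOfferIter_subset (k : ℕ) : updateOfferIter B hB x c k ⊆ B := by
  induction k with
  | zero => exact Finset.empty_subset B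
  | succ k ih => exact Finset.union_subset ih (Finset.filter_subset _ _)

theorem offerOf_updateOfferIter_le_succ (k : ℕ) :
    offerOf B hB x c (updateOfferIter B hB x c k) ≤
      offerOf B hB x c (updateOfferIter B hB x c (k + 1)) := by
  refine offerOf_le_offerOf (updateOfferIter_subset_succ k) (updateOfferIter_subset _)
    fun b hb => ?_
  rw [Finset.mem_sdiff, updateOfferIter_succ, Finset.mem_union, Finset.mem_filter] at hb
  exact (hb.1.resolve_left hb.2).2.le

/-- Every bidder in `S_k` claims less than the current offer `o(S_k)`. -/
theorem lt_offerOf_of_mem_updateOfferIter {k : ℕ} {b : ι}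
    (hb : b ∈ updateOfferIter B hB x c k) :
    x b < offerOf B hB x c (updateOfferIter B hB x c k) := by
  induction k with
  | zero => exact absurd hb (Finset.notMem_empty b)
  | succ k ih =>
    refine lt_of_lt_of_le ?_ (offerOf_updateOfferIter_le_succ k)
    rw [updateOfferIter_succ, Finset.mem_union, Finset.mem_filter] at hb
    exact hb.elim ih And.right

theorem updateOfferIter_succ_congr {j k : ℕ}
    (h : updateOfferIter B hB x c j = updateOfferIter B hB x c k) :
    updateOfferIter B hB x c (j + 1) = updateOfferIter B hB x c (k + 1) := by
  rw [updateOfferIter_succ, updateOfferIter_succ, h]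

theorem le_card_updateOfferIter_or_succ_eq (k : ℕ) :
    k ≤ (updateOfferIter B hB x c k).card ∨
      updateOfferIter B hB x c (k + 1) = updateOfferIter B hB x c k := by
  induction k with
  | zero => exact Or.inl (Nat.zero_le _)
  | succ k ih =>
    by_cases heq : updateOfferIter B hB x c (k + 1) = updateOfferIter B hB x c k
    · exact Or.inr (updateOfferIter_succ_congr heq)
    · have hlt := Finset.card_lt_card
        ((updateOfferIter_subset_succ (hB := hB) (x := x) (c := c) k).ssubset_of_ne
          (Ne.symm heq))
      exact Or.inl ((Nat.succ_le_succ (ih.resolve_right heq)).trans hlt)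

theorem updateOfferIter_card_succ :
    updateOfferIter B hB x c (B.card + 1) = updateOfferIter B hB x c B.card := by
  rcases le_card_updateOfferIter_or_succ_eq (hB := hB) (x := x) (c := c) B.card with h | h
  · refine Finset.Subset.antisymm ?_ (updateOfferIter_subset_succ _)
    rw [Finset.eq_of_subset_of_card_le (updateOfferIter_subset _) h]
    exact updateOfferIter_subset _
  · exact h

theorem updateOfferIter_eq_of_card_le {k : ℕ} (hk : B.card ≤ k) :
    updateOfferIter B hB x c k = updateOfferIter B hB x c B.card := by
  induction k, hk using Nat.le_induction with
  | base => rfl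
  | succ k _ ih => exact (updateOfferIter_succ_congr ih).trans updateOfferIter_card_succ

theorem filter_lt_offerOf_updateOfferIter_card :
    (B.filter fun b => x b < offerOf B hB x c (updateOfferIter B hB x c B.card)) =
      updateOfferIter B hB x c B.card := by
  refine Finset.Subset.antisymm ?_ fun b hb => Finset.mem_filter.2
    ⟨updateOfferIter_subset _ hb, lt_offerOf_of_mem_updateOfferIter hb⟩
  exact Finset.union_eq_left.1 (updateOfferIter_card_succ (hB := hB) (x := x) (c := c))

end UpdateOffer

/-- Correctness and termination of the `UpdateOffer` iteration: the sequence `(S_k)` is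
increasing and stabilizes after at most `|B|` steps, the offers `o(S_k)` are
nondecreasing, and the terminal offer is an auction offer for `(x, c)`. -/
theorem updateOfferIter_correct {ι : Type*} (B : Finset ι) (hB : B.Nonempty)
    (x : ι → ℝ) (hx : ∀ b ∈ B, 0 ≤ x b) (c : ℝ) (hc : 0 ≤ c) :
    (∀ k, updateOfferIter B hB x c k ⊆ updateOfferIter B hB x c (k + 1)) ∧
    (∀ k, B.card ≤ k → updateOfferIter B hB x c k = updateOfferIter B hB x c B.card) ∧
    (∀ k, offerOf B hB x c (updateOfferIter B hB x c k) ≤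
        offerOf B hB x c (updateOfferIter B hB x c (k + 1))) ∧
    IsAuctionOffer B hB x c (offerOf B hB x c (updateOfferIter B hB x c B.card)) := by
  exact ⟨updateOfferIter_subset_succ, fun _ => updateOfferIter_eq_of_card_le,
    offerOf_updateOfferIter_le_succ,
    isAuctionOffer_offerOf filter_lt_offerOf_updateOfferIter_card⟩
end

section
/- (Theorem 1) Let (D, R, w, c, (R_i), (D_j)) be a resource allocation instance and let (o_t, s_t)_{t ∈ ℕ} be a fair REACT execution. Then the execution converges in finite time: there exists T such that for all t ≥ T, s_t = s_T and o_t = o_T, and the limiting allocation s_T is a lexicographically max-min allocation for the instance. -/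
open Classical Finset

variable {D R : Type*} [Fintype D] [Fintype R]

/-- A feasible allocation `s` is lexicographically max-min if every demand is
satisfied (`s i ≥ w i`) or has a maximal claim at some saturated adjacent resource. -/
def IsLexMaxMin (I : RAInstance D R) (s : D → ℝ) : Prop :=
  IsFeasible I s ∧
  ∀ i, I.w i ≤ s i ∨
    ∃ j ∈ I.Ri i, I.c j ≤ ∑ k ∈ I.Dj j, s k ∧ s i = (I.Dj j).sup' (I.Dj_nonempty' j) s

/-- A fair REACT execution: at each step the scheduled demand updates its claim to the
minimum of its magnitude and its smallest adjacent offer, or the scheduled resource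
updates its offer to the auction offer for the adjacent claims; everything else is
unchanged, and every demand and resource is scheduled infinitely often. -/
structure ReactExecution (I : RAInstance D R) where
  o : ℕ → R → ℝ
  s : ℕ → D → ℝ
  sched : ℕ → D ⊕ R
  o_init_nonneg : ∀ j, 0 ≤ o 0 j
  s_init_nonneg : ∀ i, 0 ≤ s 0 i
  s_init_le : ∀ i, s 0 i ≤ I.w i
  fair_demand : ∀ (i : D) (t : ℕ), ∃ t', t ≤ t' ∧ sched t' = Sum.inl i
  fair_resource : ∀ (j : R) (t : ℕ), ∃ t', t ≤ t' ∧ sched t' = Sum.inr j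
  step_demand : ∀ t i, sched t = Sum.inl i →
      s (t + 1) i = min (I.w i) ((I.Ri i).inf' (I.Ri_nonempty i) (o t)) ∧
      (∀ i', i' ≠ i → s (t + 1) i' = s t i') ∧ ∀ j, o (t + 1) j = o t j
  step_resource : ∀ t j, sched t = Sum.inr j →
      IsAuctionOffer (I.Dj j) (I.Dj_nonempty' j) (s t) (I.c j) (o (t + 1) j) ∧
      (∀ j', j' ≠ j → o (t + 1) j' = o t j') ∧ ∀ i, s (t + 1) i = s t i

open Filter

/-- The amount of capacity used up when bidders with claims `x` are offered `o`; the auction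
offers for capacity `c` are the solutions `o` of `auctionLevel B hB x o = c`. -/
noncomputable def auctionLevel {ι : Type*} (B : Finset ι) (hB : B.Nonempty) (x : ι → ℝ)
    (o : ℝ) : ℝ :=
  ∑ b ∈ B, min (x b) o + max 0 (o - B.sup' hB x)

theorem isAuctionOffer_iff_auctionLevel_eq {ι : Type*} {B : Finset ι} {hB : B.Nonempty}
    {x : ι → ℝ} {c o : ℝ} : IsAuctionOffer B hB x c o ↔ auctionLevel B hB x o = c := by
  unfold IsAuctionOffer auctionLevel
  dsimp only
  split_ifs with h
  · have hlt : ∀ b ∈ B, x b < o := fun b hb => by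
      rw [← h] at hb
      exact (Finset.mem_filter.1 hb).2
    have hsup : B.sup' hB x < o := (Finset.sup'_lt_iff hB).2 hlt
    rw [h, Finset.sum_congr rfl fun b hb => min_eq_left (hlt b hb).le,
      max_eq_right (by linarith)]
    constructor <;> intro h' <;> linarith
  · obtain ⟨b, hb, hob⟩ : ∃ b ∈ B, o ≤ x b := by
      by_contra! hcon
      exact h (Finset.filter_true_of_mem hcon)
    have hsup : o ≤ B.sup' hB x := hob.trans (Finset.le_sup' x hb)
    have hbmem : b ∈ B \ B.filter fun b => x b < o := by
      simp [hb, hob]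
    have hcard : (0 : ℝ) < ((B \ B.filter fun b => x b < o).card : ℝ) := by
      exact_mod_cast Finset.card_pos.2 ⟨b, hbmem⟩
    have hsum : ∑ b ∈ B, min (x b) o = ((B \ B.filter fun b => x b < o).card : ℝ) * o
        + ∑ b ∈ B.filter (fun b => x b < o), x b := by
      rw [← Finset.sum_sdiff (Finset.filter_subset (fun b => x b < o) B), ← nsmul_eq_mul,
        ← Finset.sum_const]
      congr 1
      · refine Finset.sum_congr rfl fun k hk => min_eq_right ?_
        simp only [Finset.mem_sdiff, Finset.mem_filter, not_and, not_lt] at hk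
        exact hk.2 hk.1
      · exact Finset.sum_congr rfl fun k hk => min_eq_left (Finset.mem_filter.1 hk).2.le
    rw [max_eq_left (by linarith), eq_div_iff hcard.ne', hsum]
    constructor <;> intro h' <;> linarith

theorem auctionLevel_strictMono {ι : Type*} (B : Finset ι) (hB : B.Nonempty) (x : ι → ℝ) :
    StrictMono (auctionLevel B hB x) := by
  intro o o' hlt
  unfold auctionLevel
  have hmin : ∀ b ∈ B, min (x b) o ≤ min (x b) o' := fun b _ => min_le_min_left _ hlt.le
  have hmax : max 0 (o - B.sup' hB x) ≤ max 0 (o' - B.sup' hB x) :=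
    max_le_max_left _ (by linarith)
  rcases lt_or_ge o (B.sup' hB x) with h | h
  · obtain ⟨b, hb, hob⟩ := (Finset.lt_sup'_iff hB).1 h
    refine add_lt_add_of_lt_of_le (Finset.sum_lt_sum hmin ⟨b, hb, ?_⟩) hmax
    rw [min_eq_right hob.le]
    exact lt_min hob hlt
  · refine add_lt_add_of_le_of_lt (Finset.sum_le_sum hmin) ?_
    rw [max_eq_right (by linarith), max_eq_right (by linarith)]
    linarith

theorem IsAuctionOffer.unique {ι : Type*} {B : Finset ι} {hB : B.Nonempty} {x : ι → ℝ}
    {c o o' : ℝ} (h : IsAuctionOffer B hB x c o) (h' : IsAuctionOffer B hB x c o') : o = o' :=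
  (auctionLevel_strictMono B hB x).injective <|
    (isAuctionOffer_iff_auctionLevel_eq.1 h).trans (isAuctionOffer_iff_auctionLevel_eq.1 h').symm

theorem IsAuctionOffer.le_of_sum_le {ι : Type*} {B F : Finset ι} {hB : B.Nonempty}
    {x : ι → ℝ} {c o μ : ℝ} (h : IsAuctionOffer B hB x c o) {b : ι} (hb : b ∈ B) (hbF : b ∉ F)
    (hsum : ∑ i ∈ B, (if i ∈ F then x i else μ) ≤ c) : μ ≤ o := by
  rw [← (auctionLevel_strictMono B hB x).le_iff_le, isAuctionOffer_iff_auctionLevel_eq.1 h]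
  refine le_trans ?_ hsum
  have hgap : ∀ i ∈ B, 0 ≤ (if i ∈ F then x i else μ) - min (x i) μ := by
    intro i _
    split_ifs
    · linarith [min_le_left (x i) μ]
    · linarith [min_le_right (x i) μ]
  have hsingle := Finset.single_le_sum hgap hb
  rw [if_neg hbF, Finset.sum_sub_distrib] at hsingle
  have hmax : max 0 (μ - B.sup' hB x) ≤ μ - min (x b) μ := by
    have := Finset.le_sup' x hb
    exact max_le (by linarith [min_le_right (x b) μ]) (by linarith [min_le_left (x b) μ])
  unfold auctionLevel
  linarith

theorem IsAuctionOffer.eq_of_sum_eq {ι : Type*} {B F : Finset ι} {hB : B.Nonempty}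
    {x : ι → ℝ} {c o μ : ℝ} (h : IsAuctionOffer B hB x c o) {b : ι} (hb : b ∈ B) (hbF : b ∉ F)
    (hF : ∀ i ∈ F, x i ≤ μ) (hFc : ∀ i ∉ F, μ ≤ x i)
    (hsum : ∑ i ∈ B, (if i ∈ F then x i else μ) = c) : o = μ := by
  refine h.unique (isAuctionOffer_iff_auctionLevel_eq.2 ?_)
  rw [← hsum]
  unfold auctionLevel
  rw [max_eq_left (by linarith [hFc b hbF, Finset.le_sup' x hb]), add_zero]
  refine Finset.sum_congr rfl fun i _ => ?_
  split_ifs with hi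
  · exact min_eq_left (hF i hi)
  · exact min_eq_right (hFc i hi)

theorem eventually_of_frequent_update {X : Type*} {x : ℕ → X} {A : ℕ → Prop} {P : X → Prop}
    (hA : ∀ t, ∃ t', t ≤ t' ∧ A t') (hstay : ∀ t, ¬ A t → x (t + 1) = x t)
    (hP : ∀ᶠ t in atTop, A t → P (x (t + 1))) : ∀ᶠ t in atTop, P (x t) := by
  obtain ⟨T, hT⟩ := eventually_atTop.1 hP
  obtain ⟨t', ht', hAt'⟩ := hA T
  refine eventually_atTop.2 ⟨t' + 1, fun t ht => ?_⟩
  induction t, ht using Nat.le_induction with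
  | base => exact hT t' ht' hAt'
  | succ t ht ih =>
    by_cases h : A t
    · exact hT t (by omega) h
    · rwa [hstay t h]

namespace RAInstance

theorem mem_Dj {I : RAInstance D R} {i : D} {j : R} : i ∈ I.Dj j ↔ j ∈ I.Ri i := by
  simp [Dj]

end RAInstance

namespace ReactExecution

variable {I : RAInstance D R}

theorem eventually_offer (E : ReactExecution I) (j : R) {P : ℝ → Prop}
    (hP : ∀ᶠ t in atTop, ∀ o, IsAuctionOffer (I.Dj j) (I.Dj_nonempty' j) (E.s t) (I.c j) o → P o) :
    ∀ᶠ t in atTop, P (E.o t j) := by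
  refine eventually_of_frequent_update (x := fun t => E.o t j) (E.fair_resource j) ?_ ?_
  · intro t ht
    cases h : E.sched t with
    | inl i => exact (E.step_demand t i h).2.2 j
    | inr j' =>
      refine (E.step_resource t j' h).2.1 j ?_
      rintro rfl
      exact ht h
  · filter_upwards [hP] with t ht hs
    exact ht _ (E.step_resource t j hs).1

theorem eventually_claim (E : ReactExecution I) (i : D) {P : ℝ → Prop}
    (hP : ∀ᶠ t in atTop, P (min (I.w i) ((I.Ri i).inf' (I.Ri_nonempty i) (E.o t)))) :
    ∀ᶠ t in atTop, P (E.s t i) := by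
  refine eventually_of_frequent_update (x := fun t => E.s t i) (E.fair_demand i) ?_ ?_
  · intro t ht
    cases h : E.sched t with
    | inr j => exact (E.step_resource t j h).2.2 i
    | inl i' =>
      refine (E.step_demand t i' h).2.1 i ?_
      rintro rfl
      exact ht h
  · filter_upwards [hP] with t ht hs
    simpa only [(E.step_demand t i hs).1] using ht

/-- The claims of the demands in `F` have eventually settled at the values `v`, all remaining
demands can be served at the common level `μ`, and the settled demands are already satisfied or
bottlenecked. -/
structure PartialLimit (E : ReactExecution I) (F : Finset D) (v : D → ℝ) (μ : ℝ) : Prop where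
  settled : ∀ i ∈ F, ∀ᶠ t in atTop, E.s t i = v i
  feasible : IsFeasible I v
  level_nonneg : 0 ≤ μ
  le_level : ∀ i, v i ≤ μ
  eq_level : ∀ i ∉ F, v i = μ
  bottleneck : ∀ i ∈ F, I.w i ≤ v i ∨
    ∃ j ∈ I.Ri i, I.Dj j ⊆ F ∧ I.c j ≤ ∑ k ∈ I.Dj j, v k ∧ ∀ k ∈ I.Dj j, v k ≤ v i

theorem partialLimit_empty (E : ReactExecution I) : E.PartialLimit ∅ 0 0 where
  settled := by simp
  feasible := ⟨fun i => ⟨le_rfl, I.w_nonneg i⟩, fun j => by simpa using I.c_nonneg j⟩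
  level_nonneg := le_rfl
  le_level := by simp
  eq_level := by simp
  bottleneck := by simp

/-- The largest level to which the unsettled demands can be raised is attained at a demand that
becomes satisfied or at a resource that becomes saturated. -/
theorem PartialLimit.exists_level {E : ReactExecution I} {F : Finset D} {v : D → ℝ} {μ : ℝ}
    (h : E.PartialLimit F v μ) (hF : F ≠ univ) :
    ∃ ν, μ ≤ ν ∧ (∀ i ∉ F, ν ≤ I.w i) ∧
      (∀ j, ∑ i ∈ I.Dj j, (if i ∈ F then v i else ν) ≤ I.c j) ∧
      ∃ i ∉ F, I.w i = ν ∨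
        ∃ j ∈ I.Ri i, I.c j = ∑ i ∈ I.Dj j, (if i ∈ F then v i else ν) := by
  let n : R → Finset D := fun j => (I.Dj j).filter (· ∉ F)
  let f : D ⊕ R → ℝ := Sum.elim (fun i => I.w i - μ)
    (fun j => (I.c j - ∑ i ∈ I.Dj j, v i) / ((n j).card : ℝ))
  let S : Finset (D ⊕ R) := univ.filter fun a => Sum.elim (· ∉ F) (fun j => (n j).Nonempty) a
  obtain ⟨i₀, hi₀⟩ : ∃ i, i ∉ F := by
    by_contra! hcon
    exact hF (Finset.eq_univ_of_forall hcon)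
  have hSl : ∀ i, Sum.inl i ∈ S ↔ i ∉ F := fun i => by simp [S]
  have hSr : ∀ j, Sum.inr j ∈ S ↔ (n j).Nonempty := fun j => by simp [S]
  obtain ⟨a, haS, ha⟩ := S.exists_min_image f ⟨Sum.inl i₀, (hSl i₀).2 hi₀⟩
  have hsum : ∀ j δ, ∑ i ∈ I.Dj j, (if i ∈ F then v i else μ + δ) =
      ∑ i ∈ I.Dj j, v i + ((n j).card : ℝ) * δ := by
    intro j δ
    rw [← nsmul_eq_mul, ← Finset.sum_const, Finset.sum_filter, ← Finset.sum_add_distrib]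
    refine Finset.sum_congr rfl fun i _ => ?_
    by_cases hi : i ∈ F
    · simp [hi]
    · simp [hi, h.eq_level i hi]
  have hpos : ∀ j, (n j).Nonempty → (0 : ℝ) < ((n j).card : ℝ) := fun j hj => by
    exact_mod_cast Finset.card_pos.2 hj
  have hfnonneg : 0 ≤ f a := by
    cases a with
    | inl i =>
      have := (h.feasible.1 i).2
      rw [h.eq_level i ((hSl i).1 haS)] at this
      exact sub_nonneg.2 this
    | inr j => exact div_nonneg (sub_nonneg.2 (h.feasible.2 j)) (Nat.cast_nonneg _)
  refine ⟨μ + f a, by linarith, fun i hi => ?_, fun j => ?_, ?_⟩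
  · have : f a ≤ I.w i - μ := ha (Sum.inl i) ((hSl i).2 hi)
    linarith
  · rw [hsum]
    rcases (n j).eq_empty_or_nonempty with hj | hj
    · simpa [hj] using h.feasible.2 j
    · have : f a ≤ (I.c j - ∑ i ∈ I.Dj j, v i) / ((n j).card : ℝ) :=
        ha (Sum.inr j) ((hSr j).2 hj)
      rw [le_div_iff₀ (hpos j hj)] at this
      linarith
  · cases a with
    | inl i =>
      refine ⟨i, (hSl i).1 haS, Or.inl ?_⟩
      simp [f]
    | inr j =>
      obtain ⟨i, hi⟩ := (hSr j).1 haS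
      obtain ⟨hij, hiF⟩ := Finset.mem_filter.1 hi
      refine ⟨i, hiF, Or.inr ⟨j, RAInstance.mem_Dj.1 hij, ?_⟩⟩
      rw [hsum]
      have : ((n j).card : ℝ) * f (Sum.inr j) = I.c j - ∑ i ∈ I.Dj j, v i :=
        mul_div_cancel₀ _ (hpos j ⟨i, hi⟩).ne'
      linarith

theorem PartialLimit.extend {E : ReactExecution I} {F : Finset D} {v : D → ℝ} {μ : ℝ}
    (h : E.PartialLimit F v μ) (hF : F ≠ univ) :
    ∃ F' v' μ', F ⊂ F' ∧ E.PartialLimit F' v' μ' := by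
  obtain ⟨ν, hμν, hνw, hνc, i₀, hi₀, htight⟩ := h.exists_level hF
  let v' : D → ℝ := fun i => if i ∈ F then v i else ν
  have hv'F : ∀ i ∈ F, v' i = v i := fun i hi => if_pos hi
  have hv'Fc : ∀ i ∉ F, v' i = ν := fun i hi => if_neg hi
  have hv'le : ∀ i, v' i ≤ ν := fun i => by
    by_cases hi : i ∈ F
    · rw [hv'F i hi]
      exact (h.le_level i).trans hμν
    · exact (hv'Fc i hi).le
  have hsettled : ∀ᶠ t in atTop, ∀ i ∈ F, E.s t i = v i := by
    rw [eventually_all_finset]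
    exact h.settled
  have hsum : ∀ {t}, (∀ i ∈ F, E.s t i = v i) → ∀ j,
      ∑ i ∈ I.Dj j, (if i ∈ F then E.s t i else ν) = ∑ i ∈ I.Dj j, v' i := fun ht j =>
    Finset.sum_congr rfl fun i _ => by
      by_cases hi : i ∈ F
      · simp [v', hi, ht i hi]
      · simp [v', hi]
  have hoffer : ∀ i ∉ F, ∀ᶠ t in atTop, ∀ j ∈ I.Ri i, ν ≤ E.o t j := by
    intro i hi
    rw [eventually_all_finset]
    intro j hj
    refine E.eventually_offer j ?_
    filter_upwards [hsettled] with t ht o ho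
    exact ho.le_of_sum_le (RAInstance.mem_Dj.2 hj) hi ((hsum ht j).trans_le (hνc j))
  have hclaim : ∀ᶠ t in atTop, ∀ i ∉ F, ν ≤ E.s t i := by
    rw [eventually_all]
    intro i
    by_cases hi : i ∈ F
    · simp [hi]
    simp only [hi, not_false_eq_true, forall_const]
    refine E.eventually_claim i ?_
    filter_upwards [hoffer i hi] with t ht
    exact le_min (hνw i hi) (Finset.le_inf' _ _ ht)
  have hbottleneck : ∀ j, I.c j = ∑ i ∈ I.Dj j, v' i → ∀ i ∉ F, j ∈ I.Ri i →
      ∀ᶠ t in atTop, E.o t j = ν := by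
    intro j hj i hi hij
    refine E.eventually_offer j (P := (· = ν)) ?_
    filter_upwards [hsettled, hclaim] with t ht hc o ho
    refine ho.eq_of_sum_eq (RAInstance.mem_Dj.2 hij) hi (fun k hk => ?_) hc
      ((hsum ht j).trans hj.symm)
    rw [ht k hk]
    exact (h.le_level k).trans hμν
  refine ⟨univ.filter fun i => i ∈ F ∨ I.w i = ν ∨ ∃ j ∈ I.Ri i, I.c j = ∑ i ∈ I.Dj j, v' i,
    v', ν, ?_, ?_, ?_, h.level_nonneg.trans hμν, hv'le, ?_, ?_⟩
  · refine Finset.ssubset_iff_subset_ne.2 ⟨fun i hi => by simp [hi], fun heq => hi₀ ?_⟩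
    rw [heq]
    simp only [Finset.mem_filter, Finset.mem_univ, true_and]
    exact Or.inr htight
  · intro i hi
    by_cases hiF : i ∈ F
    · rw [hv'F i hiF]
      exact h.settled i hiF
    rw [hv'Fc i hiF]
    simp only [Finset.mem_filter, Finset.mem_univ, true_and, hiF, false_or] at hi
    rcases hi with hi | ⟨j, hj, hjc⟩
    · refine E.eventually_claim i (P := (· = ν)) ?_
      filter_upwards [hoffer i hiF] with t ht
      rw [hi]
      exact min_eq_left (Finset.le_inf' _ _ ht)
    · refine E.eventually_claim i (P := (· = ν)) ?_
      filter_upwards [hoffer i hiF, hbottleneck j hjc i hiF hj] with t ht hot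
      refine le_antisymm ?_ (le_min (hνw i hiF) (Finset.le_inf' _ _ ht))
      exact (min_le_right _ _).trans ((Finset.inf'_le _ hj).trans_eq hot)
  · refine ⟨fun i => ?_, hνc⟩
    by_cases hi : i ∈ F
    · rw [hv'F i hi]
      exact h.feasible.1 i
    · rw [hv'Fc i hi]
      exact ⟨h.level_nonneg.trans hμν, hνw i hi⟩
  · intro i hi
    refine hv'Fc i fun hiF => hi ?_
    simp [hiF]
  · intro i hi
    by_cases hiF : i ∈ F
    · rw [hv'F i hiF]
      refine (h.bottleneck i hiF).imp_right ?_
      rintro ⟨j, hj, hjF, hjc, hmax⟩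
      refine ⟨j, hj, fun k hk => by simp [hjF hk], ?_, fun k hk => ?_⟩
      · rwa [Finset.sum_congr rfl fun k hk => hv'F k (hjF hk)]
      · rw [hv'F k (hjF hk)]
        exact hmax k hk
    simp only [Finset.mem_filter, Finset.mem_univ, true_and, hiF, false_or] at hi
    rw [hv'Fc i hiF]
    refine hi.imp le_of_eq ?_
    rintro ⟨j, hj, hjc⟩
    refine ⟨j, hj, fun k hk => ?_, hjc.le, fun k _ => hv'le k⟩
    simp only [Finset.mem_filter, Finset.mem_univ, true_and]
    exact Or.inr (Or.inr ⟨j, RAInstance.mem_Dj.1 hk, hjc⟩)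

theorem PartialLimit.exists_univ {E : ReactExecution I} {F : Finset D} {v : D → ℝ} {μ : ℝ}
    (h : E.PartialLimit F v μ) : ∃ v' μ', E.PartialLimit univ v' μ' := by
  by_cases hF : F = univ
  · exact ⟨v, μ, hF ▸ h⟩
  · obtain ⟨F', v', μ', hlt, h'⟩ := h.extend hF
    have : (univ \ F').card < (univ \ F).card :=
      Finset.card_lt_card (by simpa [← Finset.compl_eq_univ_sdiff] using hlt)
    exact h'.exists_univ
termination_by (univ \ F).card

theorem PartialLimit.isLexMaxMin {E : ReactExecution I} {v : D → ℝ} {μ : ℝ}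
    (h : E.PartialLimit univ v μ) : IsLexMaxMin I v := by
  refine ⟨h.feasible, fun i => (h.bottleneck i (Finset.mem_univ i)).imp_right ?_⟩
  rintro ⟨j, hj, -, hjc, hmax⟩
  exact ⟨j, hj, hjc, le_antisymm (Finset.le_sup' v (RAInstance.mem_Dj.2 hj))
    (Finset.sup'_le _ _ hmax)⟩

end ReactExecution

/-- Theorem 1: every fair REACT execution converges in finite time, and the limiting
allocation is lexicographically max-min. -/
theorem react_converges_to_lex_max_min
    (I : RAInstance D R) (E : ReactExecution I) :
    ∃ T : ℕ, (∀ t, T ≤ t → E.s t = E.s T ∧ E.o t = E.o T) ∧ IsLexMaxMin I (E.s T) := by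
  obtain ⟨v, μ, h⟩ := E.partialLimit_empty.exists_univ
  have hs : ∀ᶠ t in atTop, E.s t = v := by
    simp only [funext_iff]
    exact eventually_all.2 fun i => h.settled i (Finset.mem_univ i)
  have ho : ∀ᶠ t in atTop, ∀ j,
      IsAuctionOffer (I.Dj j) (I.Dj_nonempty' j) v (I.c j) (E.o t j) := by
    refine eventually_all.2 fun j => E.eventually_offer j ?_
    filter_upwards [hs] with t ht o ho
    rwa [ht] at ho
  obtain ⟨T, hT⟩ := eventually_atTop.1 (hs.and ho)
  obtain ⟨hsT, hoT⟩ := hT T le_rfl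
  refine ⟨T, fun t ht => ⟨(hT t ht).1.trans hsT.symm, funext fun j => ?_⟩, ?_⟩
  · exact ((hT t ht).2 j).unique (hoT j)
  · rw [hsT]
    exact h.isLexMaxMin
end
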